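/- The set B_{ℵ₀} ∩ (q_2, q_f) is countably infinite, where q_2 is the root in (1,2) of x⁴ = 2x² + x + 1 and q_f is the root in (1,2) of x³ = 2x² − x + 1. In particular, for each n ≥ 1 there exists q^(n) ∈ (q_2, q_f) with q^(n) ↓ q_2 such that some x ∈ I_{q^(n)} has exactly countably infinitely many expansions in base q^(n). -/

import Mathlib

noncomputable section

/-- `a` is an expansion of `x` in base `q`: all digits `a n` lie in `{0,1}` and
`x = Σ_{n≥1} a_n q^{-n}` (here `a n` is the `(n+1)`-st digit, i.e. indexing is 0-based). -/
def IsExpansion (q x : ℝ) (a : ℕ → ℕ) : Prop :=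
  (∀ n, a n ≤ 1) ∧ x = ∑' n : ℕ, (a n : ℝ) / q ^ (n + 1)

/-- The set of expansions of `x` in base `q`. -/
def expansionsOf (q x : ℝ) : Set (ℕ → ℕ) := {a | IsExpansion q x a}

/-- `U_q`: the set of `x ∈ [0, 1/(q-1)]` having a unique expansion in base `q`. -/
def uniqueExpansionSet (q : ℝ) : Set ℝ :=
  {x | x ∈ Set.Icc 0 (1 / (q - 1)) ∧ ∃! a, IsExpansion q x a}

/-- `B_m` (for finite `m`): bases `q ∈ (G, 2)` for which some `x ∈ I_q` has exactly `m`
expansions in base `q`. -/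
def B (m : ℕ) : Set ℝ :=
  {q | q ∈ Set.Ioo ((1 + Real.sqrt 5) / 2) 2 ∧
    ∃ x ∈ Set.Icc (0:ℝ) (1 / (q - 1)), Cardinal.mk (expansionsOf q x) = m}

/-- `B_{ℵ₀}`: bases `q ∈ (G, 2)` for which some `x ∈ I_q` has exactly countably infinitely
many expansions in base `q`. -/
def Baleph0 : Set ℝ :=
  {q | q ∈ Set.Ioo ((1 + Real.sqrt 5) / 2) 2 ∧
    ∃ x ∈ Set.Icc (0:ℝ) (1 / (q - 1)), Cardinal.mk (expansionsOf q x) = Cardinal.aleph0}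

/-- The Thue–Morse sequence: `thueMorse n` is the parity of the number of 1s in the
binary expansion of `n`. -/
def thueMorse (n : ℕ) : ℕ := ((Nat.digits 2 n).count 1) % 2

/-- A digit `a m` of an expansion of `x` in base `q` is forced if every expansion of `x`
agreeing with `a` before position `m` also agrees at position `m`. -/
def Forced (q x : ℝ) (a : ℕ → ℕ) (m : ℕ) : Prop :=
  ∀ c : ℕ → ℕ, IsExpansion q x c → (∀ i < m, c i = a i) → c m = a m

/-! ### Elementary facts about expansions -/

/-- The sequence with first digit `d` followed by the digits of `a`. -/
def consDigit (d : ℕ) (a : ℕ → ℕ) : ℕ → ℕ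
  | 0 => d
  | n + 1 => a n

/-- The digitwise reflection `0 ↔ 1` of a sequence. -/
def reflectDigits (a : ℕ → ℕ) : ℕ → ℕ := fun n => 1 - a n

lemma consDigit_injective (d : ℕ) : Function.Injective (consDigit d) := by
  intro a b h
  funext n
  exact congrFun h (n + 1)

lemma consDigit_tail (a : ℕ → ℕ) : consDigit (a 0) (fun n => a (n + 1)) = a := by
  funext n
  cases n <;> rfl

lemma hasSum_one_div_pow {q : ℝ} (hq : 1 < q) :
    HasSum (fun n : ℕ => 1 / q ^ (n + 1)) (1 / (q - 1)) := by
  have h := (hasSum_geometric_of_lt_one (inv_nonneg.2 (by linarith : (0:ℝ) ≤ q))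
    (inv_lt_one_of_one_lt₀ hq)).mul_left q⁻¹
  have hq0 : q ≠ 0 := by linarith
  have hq1 : q - 1 ≠ 0 := by linarith
  have hterm : (fun n : ℕ => 1 / q ^ (n + 1)) = fun n : ℕ => q⁻¹ * q⁻¹ ^ n := by
    funext n
    rw [pow_succ, inv_pow]
    field_simp
  have hsum : 1 / (q - 1) = q⁻¹ * (1 - q⁻¹)⁻¹ := by
    rw [show 1 - q⁻¹ = (q - 1) / q by field_simp]
    field_simp
  rw [hterm, hsum]
  exact h

lemma summable_digits {q : ℝ} (hq : 1 < q) {a : ℕ → ℕ} (ha : ∀ n, a n ≤ 1) :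
    Summable fun n : ℕ => (a n : ℝ) / q ^ (n + 1) := by
  have hq0 : 0 < q := by linarith
  refine Summable.of_nonneg_of_le (fun n => by positivity) (fun n => ?_)
    (hasSum_one_div_pow hq).summable
  have : (a n : ℝ) ≤ 1 := by exact_mod_cast ha n
  gcongr

lemma IsExpansion.mem_Icc {q x : ℝ} (hq : 1 < q) {a : ℕ → ℕ} (h : IsExpansion q x a) :
    x ∈ Set.Icc (0 : ℝ) (1 / (q - 1)) := by
  have hq0 : 0 < q := by linarith
  rw [h.2]
  refine ⟨tsum_nonneg fun n => by positivity, ?_⟩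
  rw [← (hasSum_one_div_pow hq).tsum_eq]
  refine (summable_digits hq h.1).tsum_le_tsum (fun n => ?_) (hasSum_one_div_pow hq).summable
  have : (a n : ℝ) ≤ 1 := by exact_mod_cast h.1 n
  gcongr

lemma tsum_digits_eq {q : ℝ} (hq : 1 < q) {a : ℕ → ℕ} (ha : ∀ n, a n ≤ 1) :
    ∑' n : ℕ, (a n : ℝ) / q ^ (n + 1) =
      (a 0 + ∑' n : ℕ, (a (n + 1) : ℝ) / q ^ (n + 1)) / q := by
  have hq0 : q ≠ 0 := by linarith
  rw [(summable_digits hq ha).tsum_eq_zero_add, add_div, ← tsum_div_const]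
  congr 1
  · simp
  · refine tsum_congr fun n => ?_
    rw [pow_succ q (n + 1), div_div]

lemma isExpansion_iff_tail {q x : ℝ} (hq : 1 < q) {a : ℕ → ℕ} :
    IsExpansion q x a ↔ a 0 ≤ 1 ∧ IsExpansion q (q * x - a 0) (fun n => a (n + 1)) := by
  have hq0 : q ≠ 0 := by linarith
  constructor
  · rintro ⟨h1, h2⟩
    refine ⟨h1 0, fun n => h1 (n + 1), ?_⟩
    rw [h2, tsum_digits_eq hq h1]
    field_simp
    ring
  · rintro ⟨h0, h1, h2⟩
    have ha : ∀ n, a n ≤ 1 := fun n => by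
      cases n with
      | zero => exact h0
      | succ n => exact h1 n
    refine ⟨ha, ?_⟩
    rw [tsum_digits_eq hq ha, ← h2]
    field_simp
    ring

lemma expansionsOf_eq_union {q : ℝ} (hq : 1 < q) (x : ℝ) :
    expansionsOf q x = consDigit 0 '' expansionsOf q (q * x) ∪
      consDigit 1 '' expansionsOf q (q * x - 1) := by
  ext a
  constructor
  · intro h
    obtain ⟨h0, h1⟩ := (isExpansion_iff_tail hq).1 h
    have h01 : a 0 = 0 ∨ a 0 = 1 := by omega
    rcases h01 with h01 | h01
    · refine Or.inl ⟨fun n => a (n + 1), ?_, ?_⟩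
      · simpa [h01, expansionsOf] using h1
      · have := consDigit_tail a
        rwa [h01] at this
    · refine Or.inr ⟨fun n => a (n + 1), ?_, ?_⟩
      · simpa [h01, expansionsOf] using h1
      · have := consDigit_tail a
        rwa [h01] at this
  · rintro (⟨b, hb, rfl⟩ | ⟨b, hb, rfl⟩)
    · refine (isExpansion_iff_tail hq).2 ⟨by simp [consDigit], ?_⟩
      simpa [consDigit, expansionsOf] using hb
    · refine (isExpansion_iff_tail hq).2 ⟨by simp [consDigit], ?_⟩
      simpa [consDigit, expansionsOf] using hb

lemma expansionsOf_eq_consDigit_zero {q x : ℝ} (hq : 1 < q) (hx : q * x < 1) :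
    expansionsOf q x = consDigit 0 '' expansionsOf q (q * x) := by
  have : expansionsOf q (q * x - 1) = ∅ := by
    rw [Set.eq_empty_iff_forall_notMem]
    intro a ha
    have := (IsExpansion.mem_Icc hq ha).1
    linarith
  rw [expansionsOf_eq_union hq, this, Set.image_empty, Set.union_empty]

lemma expansionsOf_eq_consDigit_one {q x : ℝ} (hq : 1 < q) (hx : 1 / (q - 1) < q * x) :
    expansionsOf q x = consDigit 1 '' expansionsOf q (q * x - 1) := by
  have : expansionsOf q (q * x) = ∅ := by
    rw [Set.eq_empty_iff_forall_notMem]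
    intro a ha
    have := (IsExpansion.mem_Icc hq ha).2
    linarith
  rw [expansionsOf_eq_union hq, this, Set.image_empty, Set.empty_union]

lemma IsExpansion.reflect {q x : ℝ} (hq : 1 < q) {a : ℕ → ℕ} (h : IsExpansion q x a) :
    IsExpansion q (1 / (q - 1) - x) (reflectDigits a) := by
  refine ⟨fun n => Nat.sub_le _ _, ?_⟩
  rw [h.2, ← (hasSum_one_div_pow hq).tsum_eq,
    ← (hasSum_one_div_pow hq).summable.tsum_sub (summable_digits hq h.1)]
  refine tsum_congr fun n => ?_
  rw [reflectDigits, Nat.cast_sub (h.1 n), Nat.cast_one, sub_div]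

lemma reflectDigits_reflectDigits {a : ℕ → ℕ} (ha : ∀ n, a n ≤ 1) :
    reflectDigits (reflectDigits a) = a := by
  funext n
  have := ha n
  simp only [reflectDigits]
  omega

lemma expansionsOf_reflect {q : ℝ} (hq : 1 < q) (x : ℝ) :
    expansionsOf q (1 / (q - 1) - x) = reflectDigits '' expansionsOf q x := by
  ext a
  constructor
  · intro h
    refine ⟨reflectDigits a, ?_, reflectDigits_reflectDigits h.1⟩
    have := IsExpansion.reflect hq h
    rwa [sub_sub_cancel] at this
  · rintro ⟨b, hb, rfl⟩
    exact IsExpansion.reflect hq hb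

/-- Remainders of the greedy algorithm in base `q` started at `x`. -/
def greedyRemainder (q x : ℝ) : ℕ → ℝ
  | 0 => x
  | n + 1 => if 1 ≤ q * greedyRemainder q x n then q * greedyRemainder q x n - 1
      else q * greedyRemainder q x n

lemma exists_isExpansion {q x : ℝ} (hq : 1 < q) (hq2 : q ≤ 2)
    (hx : x ∈ Set.Icc (0 : ℝ) (1 / (q - 1))) : ∃ a, IsExpansion q x a := by
  have hq0 : 0 < q := by linarith
  have hq1 : 0 < q - 1 := by linarith
  have hone : 1 ≤ 1 / (q - 1) := by
    rw [le_div_iff₀ hq1]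
    linarith
  have hs : q * (1 / (q - 1)) - 1 = 1 / (q - 1) := by
    field_simp
    ring
  set g := greedyRemainder q x with hg
  have hmem : ∀ n, g n ∈ Set.Icc (0 : ℝ) (1 / (q - 1)) := by
    intro n
    induction n with
    | zero => exact hx
    | succ n ih =>
      have hle : q * g n ≤ q * (1 / (q - 1)) := mul_le_mul_of_nonneg_left ih.2 hq0.le
      have hnn : 0 ≤ q * g n := mul_nonneg hq0.le ih.1
      simp only [hg, greedyRemainder] at *
      split_ifs with h
      · exact ⟨by linarith, by linarith⟩
      · exact ⟨hnn, by linarith [not_le.1 h]⟩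
  let a : ℕ → ℕ := fun n => if 1 ≤ q * g n then 1 else 0
  have ha : ∀ n, a n ≤ 1 := fun n => by
    simp only [a]
    split_ifs <;> norm_num
  have hstep : ∀ n, g (n + 1) = q * g n - a n := by
    intro n
    simp only [a, hg, greedyRemainder]
    split_ifs <;> simp
  have hpartial : ∀ n, ∑ i ∈ Finset.range n, (a i : ℝ) / q ^ (i + 1) = x - g n / q ^ n := by
    intro n
    induction n with
    | zero => simp [hg, greedyRemainder]
    | succ n ih =>
      rw [Finset.sum_range_succ, ih, hstep, pow_succ]
      field_simp
      ring
  have hlim : Filter.Tendsto (fun n => g n / q ^ n) Filter.atTop (nhds 0) := by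
    have h0 : Filter.Tendsto (fun n : ℕ => (1 / (q - 1)) * (q⁻¹) ^ n) Filter.atTop
        (nhds ((1 / (q - 1)) * 0)) :=
      (tendsto_pow_atTop_nhds_zero_of_lt_one (by positivity)
        (inv_lt_one_of_one_lt₀ hq)).const_mul _
    rw [mul_zero] at h0
    refine squeeze_zero (fun n => div_nonneg (hmem n).1 (by positivity)) (fun n => ?_) h0
    rw [inv_pow, div_eq_mul_inv (g n)]
    exact mul_le_mul_of_nonneg_right (hmem n).2 (by positivity)
  refine ⟨a, ha, ?_⟩
  refine tendsto_nhds_unique ?_ (summable_digits hq ha).hasSum.tendsto_sum_nat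
  simp_rw [hpartial]
  simpa using hlim.const_sub x

/-! ### Self-similar sets of sequences -/

lemma cardinalMk_eq_aleph0_of_eq_insert_image {S : Set (ℕ → ℕ)} {c : ℕ → ℕ}
    {φ : (ℕ → ℕ) → ℕ → ℕ} (hS : S = insert c (φ '' S)) (hinj : Set.InjOn φ S)
    (hc : c ∉ φ '' S)
    (hφ : ∀ m a b, (∀ i < m, a i = b i) → ∀ i < m + 1, φ a i = φ b i) :
    Cardinal.mk S = Cardinal.aleph0 := by
  have hcS : c ∈ S := by
    rw [hS]
    exact Set.mem_insert _ _
  have hmaps : Set.MapsTo φ S S := fun a ha => by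
    rw [hS]
    exact Set.mem_insert_of_mem _ ⟨a, ha, rfl⟩
  have hiter : ∀ k, φ^[k] c ∈ S := fun k => hmaps.iterate k hcS
  have hinf : S.Infinite := by
    intro hfin
    have himage : φ '' S = S :=
      Set.eq_of_subset_of_ncard_le hmaps.image_subset hinj.ncard_image.ge hfin
    exact hc (himage.symm ▸ hcS)
  have hcount : S.Countable := by
    let T : Set (ℕ → ℕ) := S \ Set.range fun k => φ^[k] c
    have hT : ∀ a ∈ T, ∃ b ∈ T, φ b = a := by
      rintro a ⟨haS, haR⟩
      rw [hS] at haS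
      rcases haS with rfl | ⟨b, hb, rfl⟩
      · exact absurd ⟨0, rfl⟩ haR
      · refine ⟨b, ⟨hb, ?_⟩, rfl⟩
        rintro ⟨k, rfl⟩
        exact haR ⟨k + 1, Function.iterate_succ_apply' φ k c⟩
    have hagree : ∀ m, ∀ a ∈ T, ∀ b ∈ T, ∀ i < m, a i = b i := by
      intro m
      induction m with
      | zero => simp
      | succ m ih =>
        intro a ha b hb
        obtain ⟨a', ha', rfl⟩ := hT a ha
        obtain ⟨b', hb', rfl⟩ := hT b hb
        exact hφ m a' b' (ih a' ha' b' hb')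
    have hTsub : T.Subsingleton := fun a ha b hb =>
      funext fun i => hagree (i + 1) a ha b hb i (Nat.lt_succ_self i)
    refine (hTsub.countable.union (Set.countable_range fun k => φ^[k] c)).mono ?_
    intro a ha
    by_cases h : a ∈ Set.range fun k => φ^[k] c
    · exact Or.inr h
    · exact Or.inl ⟨ha, h⟩
  exact le_antisymm (Cardinal.le_aleph0_iff_set_countable.2 hcount)
    (Cardinal.infinite_iff.1 hinf.to_subtype)

/-! ### Points with countably many expansions -/

lemma expansionsOf_alternating {q ε : ℝ} (hq : 1 < q) (hG : q + 1 < q ^ 2) (hε : 0 ≤ ε)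
    (h : 1 / (q - 1) < q * (q / (q ^ 2 - 1) - ε)) :
    expansionsOf q (q / (q ^ 2 - 1) - ε) =
      (consDigit 1 ∘ consDigit 0) '' expansionsOf q (q / (q ^ 2 - 1) - q ^ 2 * ε) := by
  have hq0 : 0 < q := by linarith
  have hD : 0 < q ^ 2 - 1 := by nlinarith
  have h1 : q * (q / (q ^ 2 - 1)) - 1 = 1 / (q ^ 2 - 1) := by
    field_simp
    ring
  have h2 : q * (q * (q / (q ^ 2 - 1) - ε) - 1) = q / (q ^ 2 - 1) - q ^ 2 * ε := by
    linear_combination q * h1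
  have h3 : q / (q ^ 2 - 1) < 1 := by
    rw [div_lt_one hD]
    linarith
  rw [expansionsOf_eq_consDigit_one hq h, expansionsOf_eq_consDigit_zero hq, h2, Set.image_comp]
  rw [h2]
  nlinarith [mul_nonneg (sq_nonneg q) hε]

lemma expansionsOf_existsUnique {q : ℝ} (hq : 1 < q) (hq2 : q ≤ 2) (hG : q + 1 < q ^ 2) :
    ∃ d, expansionsOf q (q / (q ^ 2 - 1)) = {d} := by
  have hq0 : 0 < q := by linarith
  have hq1 : 0 < q - 1 := by linarith
  have hD : 0 < q ^ 2 - 1 := by nlinarith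
  have hs : 1 / (q - 1) = (q + 1) / (q ^ 2 - 1) := by
    rw [div_eq_div_iff hq1.ne' hD.ne']
    ring
  have hrec := expansionsOf_alternating (ε := 0) hq hG le_rfl (by
    rw [hs, sub_zero, mul_div_assoc']
    gcongr
    nlinarith)
  rw [mul_zero, sub_zero] at hrec
  obtain ⟨d, hd⟩ := exists_isExpansion hq hq2 (x := q / (q ^ 2 - 1))
    ⟨by positivity, by rw [hs]; gcongr; linarith⟩
  refine ⟨d, Set.eq_singleton_iff_unique_mem.2 ⟨hd, fun b hb => ?_⟩⟩
  have hagree : ∀ m, ∀ a ∈ expansionsOf q (q / (q ^ 2 - 1)),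
      ∀ b ∈ expansionsOf q (q / (q ^ 2 - 1)), ∀ i < m, a i = b i := by
    intro m
    induction m with
    | zero => simp
    | succ m ih =>
      intro a ha b hb i hi
      rw [hrec] at ha hb
      obtain ⟨a', ha', rfl⟩ := ha
      obtain ⟨b', hb', rfl⟩ := hb
      match i with
      | 0 => rfl
      | 1 => rfl
      | i + 2 => exact ih a' ha' b' hb' i (by omega)
  exact funext fun i => hagree (i + 1) b hb d hd i (Nat.lt_succ_self i)

lemma consDigit_agree {d m : ℕ} {a b : ℕ → ℕ} (h : ∀ i < m, a i = b i) :
    ∀ i < m + 1, consDigit d a i = consDigit d b i := by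
  intro i hi
  cases i with
  | zero => rfl
  | succ i => exact h i (by omega)

lemma iterate_agree {f : (ℕ → ℕ) → ℕ → ℕ} {m : ℕ}
    (hf : ∀ a b, (∀ i < m, a i = b i) → ∀ i < m, f a i = f b i) (k : ℕ) :
    ∀ a b, (∀ i < m, a i = b i) → ∀ i < m, f^[k] a i = f^[k] b i := by
  induction k with
  | zero => exact fun a b h => h
  | succ k ih =>
    intro a b h
    rw [Function.iterate_succ_apply, Function.iterate_succ_apply]
    exact ih _ _ (hf a b h)

lemma mk_expansionsOf_eq_aleph0 {q : ℝ} {n : ℕ} (hq : 17 / 10 < q) (hq2 : q ≤ 2)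
    (h : q ^ (2 * n + 3) * (q ^ 4 - 2 * q ^ 2 - q - 1) = 1) :
    ∃ x, Cardinal.mk (expansionsOf q x) = Cardinal.aleph0 := by
  have hq1 : 1 < q := by linarith
  have hq0 : 0 < q := by linarith
  have hqm : 0 < q - 1 := by linarith
  have hG : q + 1 < q ^ 2 := by nlinarith
  have hD : 0 < q ^ 2 - 1 := by nlinarith
  have hs : 1 / (q - 1) = (q + 1) / (q ^ 2 - 1) := by
    rw [div_eq_div_iff hqm.ne' hD.ne']
    ring
  set p := q / (q ^ 2 - 1) with hp
  set E := 1 / (q ^ 2 * (q + 1)) with hE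
  have hE0 : 0 < E := by positivity
  have hp1 : p < 1 := by
    rw [hp, div_lt_one hD]
    linarith
  have hEp : E < p := by
    rw [hE, hp, div_lt_div_iff₀ (by positivity) hD]
    nlinarith [pow_pos hq0 3]
  -- the orbit follows the period-two orbit for `2 * n` steps
  have hgap : 1 / (q - 1) < q * (p - E / q ^ 2) := by
    have : q * (p - E / q ^ 2) - 1 / (q - 1) =
        (q ^ 5 - q ^ 4 - q ^ 3 - q + 1) / (q ^ 3 * (q ^ 2 - 1)) := by
      rw [hs, hp, hE]
      have : q ^ 2 - 1 = (q - 1) * (q + 1) := by ring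
      rw [this]
      field_simp
      ring
    have hnum : 0 < q ^ 5 - q ^ 4 - q ^ 3 - q + 1 := by
      have h1 : (17 / 10 : ℝ) * (17 / 10) - 17 / 10 - 1 ≤ q ^ 2 - q - 1 := by nlinarith
      have h2 : (17 / 10 : ℝ) ^ 3 ≤ q ^ 3 := by gcongr
      have h3 : q ^ 5 - q ^ 4 - q ^ 3 - q + 1 = q ^ 3 * (q ^ 2 - q - 1) - q + 1 := by ring
      have h4 : (289 / 100 : ℝ) * q - 17 / 10 * q - q ≤ q * (q ^ 2 - q - 1) := by nlinarith
      have h5 : (289 / 100 : ℝ) ≤ q ^ 2 := by nlinarith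
      have h6 : q ^ 2 * (q * (19 / 100)) ≤ q ^ 2 * (q * (q ^ 2 - q - 1)) := by
        apply mul_le_mul_of_nonneg_left _ (sq_nonneg q)
        nlinarith
      nlinarith
    have : 0 < q * (p - E / q ^ 2) - 1 / (q - 1) := by
      rw [this]
      positivity
    linarith
  have halt : ∀ k : ℕ, expansionsOf q (p - E / q ^ (2 * k)) =
      (consDigit 1 ∘ consDigit 0)^[k] '' expansionsOf q (p - E) := by
    intro k
    induction k with
    | zero => simp
    | succ k ih =>
      have hle : E / q ^ (2 * (k + 1)) ≤ E / q ^ 2 := by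
        gcongr
        · exact hq1.le
        · omega
      have hstep := expansionsOf_alternating (ε := E / q ^ (2 * (k + 1))) hq1 hG (by positivity)
        (hgap.trans_le (by gcongr))
      have hdiv : q ^ 2 * (E / q ^ (2 * (k + 1))) = E / q ^ (2 * k) := by
        rw [show 2 * (k + 1) = 2 * k + 2 by ring, pow_add]
        field_simp
      rw [hdiv] at hstep
      rw [hp, hstep, ← hp, ih, ← Set.image_comp, ← Function.iterate_succ']
  set w := p - E / q ^ (2 * n) with hw
  set z := w / q ^ 4 with hz
  have hw1 : w < 1 := by
    have : 0 < E / q ^ (2 * n) := by positivity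
    linarith
  have hw0 : 0 < w := by
    have : E / q ^ (2 * n) ≤ E := div_le_self hE0.le (one_le_pow₀ hq1.le)
    linarith
  have hzero : ∀ k : ℕ, expansionsOf q (w / q ^ k) = (consDigit 0)^[k] '' expansionsOf q w := by
    intro k
    induction k with
    | zero => simp
    | succ k ih =>
      have hk : q * (w / q ^ (k + 1)) = w / q ^ k := by
        rw [pow_succ]
        field_simp
      rw [expansionsOf_eq_consDigit_zero hq1, hk, Function.iterate_succ', Set.image_comp, ← ih]
      rw [hk]
      exact (div_le_self hw0.le (one_le_pow₀ hq1.le)).trans_lt hw1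
  -- the two branches at the end of the orbit segment
  have hbranch1 : q * (p - E) - 1 = p / q ^ 2 := by
    rw [hp, hE]
    have : q ^ 2 - 1 = (q - 1) * (q + 1) := by ring
    rw [this]
    field_simp
    ring
  have hr : E / q ^ (2 * n) = q * (q ^ 4 - 2 * q ^ 2 - q - 1) / (q + 1) := by
    rw [hE, div_div, div_eq_div_iff (by positivity) (by positivity)]
    calc 1 * (q + 1) = (q ^ (2 * n + 3) * (q ^ 4 - 2 * q ^ 2 - q - 1)) * (q + 1) := by rw [h]
      _ = _ := by ring
  have hbranch0 : q * (p - E) = 1 / (q - 1) - z := by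
    rw [hz, hw, hr, hs, hp, hE]
    have : q ^ 2 - 1 = (q - 1) * (q + 1) := by ring
    rw [this]
    field_simp
    ring
  obtain ⟨d, hd⟩ := expansionsOf_existsUnique hq1 hq2 hG
  have hp2 : expansionsOf q (p / q ^ 2) = {consDigit 0 (consDigit 0 d)} := by
    have e1 : q * (p / q ^ 2) = p / q := by field_simp
    have e2 : q * (p / q) = p := by field_simp
    have hp0 : 0 < p := hE0.trans hEp
    rw [expansionsOf_eq_consDigit_zero hq1, e1, expansionsOf_eq_consDigit_zero hq1, e2, hp, hd,
      Set.image_singleton, Set.image_singleton]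
    · rwa [e2]
    · rw [e1]
      exact (div_le_self hp0.le hq1.le).trans_lt hp1
  let ψ : (ℕ → ℕ) → ℕ → ℕ := (consDigit 0)^[4] ∘ (consDigit 1 ∘ consDigit 0)^[n]
  have hψ : Function.Injective ψ := ((consDigit_injective 0).iterate 4).comp
    (((consDigit_injective 1).comp (consDigit_injective 0)).iterate n)
  have hset : expansionsOf q z = insert (ψ (consDigit 1 (consDigit 0 (consDigit 0 d))))
      ((ψ ∘ consDigit 0 ∘ reflectDigits) '' expansionsOf q z) := by
    conv_lhs => rw [hz, hzero 4, hw, halt n, expansionsOf_eq_union hq1, hbranch1, hp2,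
      hbranch0, expansionsOf_reflect hq1, ← Set.image_comp, Set.image_singleton,
      Set.union_singleton, Set.image_insert_eq, ← Set.image_comp, ← Set.image_comp]
    rfl
  refine ⟨z, cardinalMk_eq_aleph0_of_eq_insert_image hset ?_ ?_ ?_⟩
  · intro a ha b hb hab
    have := consDigit_injective 0 (hψ hab)
    rw [← reflectDigits_reflectDigits ha.1, this, reflectDigits_reflectDigits hb.1]
  · rintro ⟨b, -, hb⟩
    exact zero_ne_one (congrFun (hψ hb) 0)
  · intro m a b hab
    have hψm : ∀ a b, (∀ i < m + 1, a i = b i) → ∀ i < m + 1, ψ a i = ψ b i := by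
      have hc : ∀ d a b, (∀ i < m + 1, a i = b i) →
          ∀ i < m + 1, consDigit d a i = consDigit d b i :=
        fun d a b h i hi => consDigit_agree h i (by omega)
      intro a b h
      exact iterate_agree (hc 0) 4 _ _ (iterate_agree (fun a b h => hc 1 _ _ (hc 0 _ _ h)) n _ _ h)
    refine hψm _ _ (consDigit_agree fun i hi => ?_)
    simp only [reflectDigits, hab i hi]

/-! ### Isolated expansions -/

lemma isClosed_expansionsOf {q : ℝ} (hq : 1 < q) (x : ℝ) : IsClosed (expansionsOf q x) := by
  have hq0 : 0 < q := by linarith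
  have hcont : Continuous fun a : ℕ → ℕ => ∑' n : ℕ, (min (a n) 1 : ℕ) / q ^ (n + 1) := by
    refine continuous_tsum (fun n => ?_) (hasSum_one_div_pow hq).summable fun n a => ?_
    · have : Continuous fun m : ℕ => ((min m 1 : ℕ) : ℝ) / q ^ (n + 1) :=
        continuous_of_discreteTopology
      exact this.comp (continuous_apply n)
    · rw [Real.norm_of_nonneg (by positivity)]
      have : ((min (a n) 1 : ℕ) : ℝ) ≤ 1 := by exact_mod_cast min_le_right _ _
      gcongr
  have heq : expansionsOf q x = (⋂ n, {a : ℕ → ℕ | a n ≤ 1}) ∩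
      {a | x = ∑' n : ℕ, ((min (a n) 1 : ℕ) : ℝ) / q ^ (n + 1)} := by
    ext a
    simp only [expansionsOf, IsExpansion, Set.mem_ofPred_eq, Set.mem_inter_iff, Set.mem_iInter]
    refine and_congr_right fun h => ?_
    simp_rw [min_eq_left (h _)]
  rw [heq]
  exact (isClosed_iInter fun n => isClosed_le (continuous_apply n) continuous_const).inter
    (isClosed_eq continuous_const hcont)

lemma exists_isolated_of_isClosed_countable {K : Set (ℕ → ℕ)} (hK : IsClosed K)
    (hcount : K.Countable) (hne : K.Nonempty) :
    ∃ a ∈ K, ∃ N, ∀ b ∈ K, (∀ i < N, b i = a i) → b = a := by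
  have : Countable K := hcount.to_subtype
  have : Nonempty K := hne.to_subtype
  have : PolishSpace K := hK.polishSpace
  obtain ⟨a, ha⟩ := nonempty_interior_of_iUnion_of_closed (f := fun a : K => ({a} : Set K))
    (fun a => isClosed_singleton) (Set.iUnion_of_singleton K)
  have hopen : IsOpen ({a} : Set K) := by
    have : interior ({a} : Set K) = {a} :=
      (Set.subset_singleton_iff_eq.1 interior_subset).resolve_left ha.ne_empty
    exact this ▸ isOpen_interior
  obtain ⟨U, hU, hUa⟩ := isOpen_induced_iff.1 hopen
  have haU : (a : ℕ → ℕ) ∈ U := by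
    have : a ∈ Subtype.val ⁻¹' U := hUa ▸ Set.mem_singleton a
    exact this
  obtain ⟨_, ⟨y, N, rfl⟩, hay, hsub⟩ :=
    (PiNat.isTopologicalBasis_cylinders fun _ : ℕ => ℕ).exists_subset_of_mem_open haU hU
  refine ⟨a, a.2, N, fun b hb hab => ?_⟩
  have hbU : (⟨b, hb⟩ : K) ∈ Subtype.val ⁻¹' U :=
    hsub fun i hi => (hab i hi).trans (hay i hi)
  rw [hUa] at hbU
  exact congrArg Subtype.val hbU

lemma exists_isolated_expansion {q x : ℝ} (hq : 1 < q) (hcount : (expansionsOf q x).Countable)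
    {a : ℕ → ℕ} (ha : a ∈ expansionsOf q x) (m : ℕ) :
    ∃ b ∈ expansionsOf q x, b m = a m ∧
      ∃ N, ∀ c ∈ expansionsOf q x, (∀ i < N, c i = b i) → c = b := by
  obtain ⟨b, ⟨hb, hbm⟩, N, hN⟩ := exists_isolated_of_isClosed_countable
    (K := expansionsOf q x ∩ {c | c m = a m})
    ((isClosed_expansionsOf hq x).inter (isClosed_eq (continuous_apply m) continuous_const))
    (hcount.mono Set.inter_subset_left) ⟨a, ha, rfl⟩
  refine ⟨b, hb, hbm, max N (m + 1), fun c hc hcb => hN c ⟨hc, ?_⟩ fun i hi => ?_⟩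
  · exact (hcb m (by omega)).trans hbm
  · exact hcb i (by omega)

/-! ### Unique expansions below `q_f` -/

lemma IsExpansion.splice {q : ℝ} (hq : 1 < q) (n : ℕ) : ∀ {x : ℝ} {a b : ℕ → ℕ},
    IsExpansion q x a → IsExpansion q (∑' i : ℕ, (a (n + i) : ℝ) / q ^ (i + 1)) b →
    IsExpansion q x (fun i => if i < n then a i else b (i - n)) := by
  induction n with
  | zero =>
    intro x a b ha hb
    simp only [zero_add] at hb
    rw [← ha.2] at hb
    simpa using hb
  | succ n ih =>
    intro x a b ha hb
    rw [isExpansion_iff_tail hq] at ha ⊢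
    refine ⟨by simpa using ha.1, ?_⟩
    have := ih ha.2 (b := b) (by simpa only [add_right_comm n _ 1] using hb)
    simpa [Nat.succ_lt_succ_iff] using this

lemma tail_lt_one_of_isolated {q x : ℝ} (hq : 1 < q) (hq2 : q ≤ 2) {a : ℕ → ℕ} {N : ℕ}
    (ha : IsExpansion q x a) (hN : ∀ c ∈ expansionsOf q x, (∀ i < N, c i = a i) → c = a)
    {n : ℕ} (hn : N ≤ n) (han : a n = 0) :
    ∑' i : ℕ, (a (n + 1 + i) : ℝ) / q ^ (i + 1) < 1 := by
  by_contra! hge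
  set t := ∑' i : ℕ, (a (n + 1 + i) : ℝ) / q ^ (i + 1) with ht
  have htail : IsExpansion q t fun i => a (n + 1 + i) := ⟨fun i => ha.1 _, rfl⟩
  have htle := (htail.mem_Icc hq).2
  obtain ⟨d, hd⟩ := exists_isExpansion hq hq2 (x := t - 1) ⟨by linarith, by linarith⟩
  have hd' : IsExpansion q (∑' i : ℕ, (a (n + i) : ℝ) / q ^ (i + 1)) (consDigit 1 d) := by
    have hq0 : q ≠ 0 := by linarith
    rw [isExpansion_iff_tail hq]
    refine ⟨le_rfl, ?_⟩
    rw [tsum_digits_eq hq (a := fun i => a (n + i)) fun i => ha.1 _]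
    simp only [add_zero, han, Nat.cast_zero, zero_add, ← add_assoc, add_right_comm n _ 1,
      mul_div_cancel₀ _ hq0, ← ht, consDigit, Nat.cast_one]
    exact hd
  have := hN _ (IsExpansion.splice hq n ha hd') fun i hi => if_pos (by omega)
  have := congrFun this n
  simp [consDigit, han] at this

lemma not_zero_one_one_of_isolated {q x : ℝ} (hq : 1 < q) (hq2 : q ≤ 2)
    (hqf : q ^ 3 ≤ 2 * q ^ 2 - q + 1) {a : ℕ → ℕ} {N : ℕ}
    (ha : IsExpansion q x a) (hN : ∀ c ∈ expansionsOf q x, (∀ i < N, c i = a i) → c = a)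
    {n : ℕ} (hn : N ≤ n) (h0 : a n = 0) (h1 : a (n + 1) = 1) (h2 : a (n + 2) = 1) : False := by
  have hq0 : 0 < q := by linarith
  have hqm : 0 < q - 1 := by linarith
  have ht := tail_lt_one_of_isolated hq hq2 ha hN hn h0
  have hr := tail_lt_one_of_isolated (x := 1 / (q - 1) - x) (a := reflectDigits a) (N := N)
    (n := n + 2) hq hq2 (ha.reflect hq) (fun c hc hca => by
      have hc' : reflectDigits c ∈ expansionsOf q x := by
        have := IsExpansion.reflect hq hc
        rwa [sub_sub_cancel] at this
      rw [← reflectDigits_reflectDigits hc.1, hN _ hc' fun i hi => by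
        have := ha.1 i
        have := hca i hi
        simp only [reflectDigits] at *
        omega])
    (by omega) (by simp [reflectDigits, h2])
  set s := ∑' i : ℕ, (a (n + 2 + 1 + i) : ℝ) / q ^ (i + 1) with hs
  have hsum : IsExpansion q s fun i => a (n + 2 + 1 + i) := ⟨fun i => ha.1 _, rfl⟩
  have hrefl := (hsum.reflect hq).2
  simp only [reflectDigits] at hr hrefl
  rw [← hrefl] at hr
  rw [tsum_digits_eq hq (a := fun i => a (n + 1 + i)) fun i => ha.1 _,
    tsum_digits_eq hq (a := fun i => a (n + 1 + (i + 1))) fun i => ha.1 _] at ht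
  have hs' : ∑' i : ℕ, (a (n + 1 + (i + 1 + 1)) : ℝ) / q ^ (i + 1) = s :=
    tsum_congr fun i => by rw [show n + 1 + (i + 1 + 1) = n + 2 + 1 + i by ring]
  rw [hs'] at ht
  simp only [add_zero, zero_add, h1, add_assoc n 1 1, Nat.reduceAdd, h2, Nat.cast_one] at ht
  rw [div_lt_one hq0, ← lt_sub_iff_add_lt', div_lt_iff₀ hq0] at ht
  have h3 : 1 / (q - 1) < 1 + s := by linarith
  rw [div_lt_iff₀ hqm] at h3
  nlinarith

lemma eventually_periodic_of_isolated {q x : ℝ} (hq : 1 < q) (hq2 : q ≤ 2)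
    (hqf : q ^ 3 ≤ 2 * q ^ 2 - q + 1) {a : ℕ → ℕ} {N : ℕ}
    (ha : IsExpansion q x a) (hN : ∀ c ∈ expansionsOf q x, (∀ i < N, c i = a i) → c = a) :
    ∃ M, ∀ n, M ≤ n → a (n + 2) = a n := by
  have hchange : ∀ n, N ≤ n → a n ≠ a (n + 1) → a (n + 2) = a n := by
    intro n hn hne
    have b0 := ha.1 n
    have b1 := ha.1 (n + 1)
    have b2 := ha.1 (n + 2)
    by_contra hne2
    have hcases : a n = 0 ∧ a (n + 1) = 1 ∧ a (n + 2) = 1 ∨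
        a n = 1 ∧ a (n + 1) = 0 ∧ a (n + 2) = 0 := by omega
    rcases hcases with ⟨h0, h1, h2⟩ | ⟨h0, h1, h2⟩
    · exact not_zero_one_one_of_isolated hq hq2 hqf ha hN hn h0 h1 h2
    · refine not_zero_one_one_of_isolated (x := 1 / (q - 1) - x) (a := reflectDigits a) hq hq2
        hqf (ha.reflect hq) (N := N) (fun c hc hca => ?_) hn ?_ ?_ ?_
      · have hc' : reflectDigits c ∈ expansionsOf q x := by
          have := IsExpansion.reflect hq hc
          rwa [sub_sub_cancel] at this
        rw [← reflectDigits_reflectDigits hc.1, hN _ hc' fun i hi => by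
          have := ha.1 i
          have := hca i hi
          simp only [reflectDigits] at *
          omega]
      all_goals simp [reflectDigits, h0, h1, h2]
  by_cases hconst : ∃ M, N ≤ M ∧ a M ≠ a (M + 1)
  · obtain ⟨M, hM, hne⟩ := hconst
    have hall : ∀ k, a (M + k) ≠ a (M + k + 1) := by
      intro k
      induction k with
      | zero => exact hne
      | succ k ih =>
        have := hchange (M + k) (by omega) ih
        rw [← add_assoc, show M + k + 1 + 1 = M + k + 2 by ring, this]
        exact ih.symm
    refine ⟨M, fun n hn => ?_⟩
    obtain ⟨k, rfl⟩ := Nat.exists_eq_add_of_le hn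
    exact hchange _ (by omega) (hall k)
  · push Not at hconst
    exact ⟨N, fun n hn => by rw [← hconst (n + 1) (by omega), ← hconst n hn]⟩

/-! ### Countability -/

lemma isAlgebraic_of_hasSum_zero {q : ℝ} (hq : 1 < q) {c : ℕ → ℤ} {N m : ℕ}
    (hc : ∀ n, N ≤ n → c (n + 2) = c n) (hm : c m ≠ 0)
    (hsum : HasSum (fun n => (c n : ℝ) * (q⁻¹) ^ n) 0) : IsAlgebraic ℤ q := by
  classical
  have hq0 : q ≠ 0 := by linarith
  set e : ℕ → ℤ := fun n => if n < 2 then 0 else c (n - 2) with he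
  have hshift : HasSum (fun n => (e n : ℝ) * (q⁻¹) ^ n) 0 := by
    rw [← hasSum_nat_add_iff' 2]
    have h2 := hsum.mul_left (q⁻¹ ^ 2)
    simp only [he, Finset.sum_range_succ, Finset.sum_range_zero]
    simpa [pow_add, mul_assoc, mul_comm, mul_left_comm] using h2
  have hdiff := hsum.sub hshift
  have hzero : ∀ n ∉ Finset.range (N + 2),
      (c n : ℝ) * (q⁻¹) ^ n - (e n : ℝ) * (q⁻¹) ^ n = 0 := by
    intro n hn
    rw [Finset.mem_range, not_lt] at hn
    have h := hc (n - 2) (by omega)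
    rw [Nat.sub_add_cancel (by omega)] at h
    simp only [he, if_neg (show ¬ n < 2 by omega), h, sub_self]
  have hfin := (hasSum_sum_of_ne_finset_zero hzero).unique hdiff
  have hex : ∃ n, c n ≠ 0 := ⟨m, hm⟩
  set k := Nat.find hex with hk
  have hck : c k ≠ 0 := Nat.find_spec hex
  have hek : e k = 0 := by
    simp only [he]
    split_ifs with h
    · rfl
    · exact not_not.1 (Nat.find_min hex (m := k - 2) (by omega))
  have hkN : k < N + 2 := by
    by_contra hle
    have h := hc (k - 2) (by omega)
    rw [Nat.sub_add_cancel (by omega)] at h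
    simp only [he, if_neg (show ¬ k < 2 by omega)] at hek
    exact hck (h.trans hek)
  let P : Polynomial ℤ := ∑ n ∈ Finset.range (N + 2), Polynomial.monomial n (c n - e n)
  have hP : P ≠ 0 := by
    intro h
    have hcoeff : P.coeff k = c k - e k := by
      simp only [P, Polynomial.finsetSum_coeff, Polynomial.coeff_monomial]
      rw [Finset.sum_ite_eq' (Finset.range (N + 2)) k, if_pos (Finset.mem_range.2 hkN)]
    rw [h, Polynomial.coeff_zero, hek, sub_zero] at hcoeff
    exact hck hcoeff.symm
  have hroot : Polynomial.aeval q⁻¹ P = 0 := by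
    simp only [P, map_sum, Polynomial.aeval_monomial]
    rw [← sub_self (0 : ℝ), ← hfin]
    refine Finset.sum_congr rfl fun n _ => ?_
    simp [sub_mul]
  have : IsAlgebraic ℤ q⁻¹ := ⟨P, hP, hroot⟩
  exact IsAlgebraic.inv_iff.1 this

lemma isAlgebraic_of_mk_expansionsOf_eq_aleph0 {q x : ℝ} (hq : 1 < q) (hq2 : q ≤ 2)
    (hqf : q ^ 3 ≤ 2 * q ^ 2 - q + 1)
    (hx : Cardinal.mk (expansionsOf q x) = Cardinal.aleph0) : IsAlgebraic ℤ q := by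
  have hcount : (expansionsOf q x).Countable := Cardinal.le_aleph0_iff_set_countable.1 hx.le
  have hinf : (expansionsOf q x).Infinite :=
    Set.infinite_coe_iff.1 (Cardinal.infinite_iff.2 hx.ge)
  obtain ⟨a, ha, b, hb, hab⟩ := hinf.nontrivial
  obtain ⟨m, hm⟩ := Function.ne_iff.1 hab
  obtain ⟨a', ha', ham, N, hN⟩ := exists_isolated_expansion hq hcount ha m
  obtain ⟨b', hb', hbm, N', hN'⟩ := exists_isolated_expansion hq hcount hb m
  obtain ⟨M, hM⟩ := eventually_periodic_of_isolated hq hq2 hqf ha' hN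
  obtain ⟨M', hM'⟩ := eventually_periodic_of_isolated hq hq2 hqf hb' hN'
  refine isAlgebraic_of_hasSum_zero (c := fun n => (a' n : ℤ) - b' n) (N := max M M') (m := m) hq
    (fun n hn => ?_) ?_ ?_
  · simp only [hM n (by omega), hM' n (by omega)]
  · rw [ham, hbm]
    omega
  · have hq0 : q ≠ 0 := by linarith
    have h := ((summable_digits hq ha'.1).hasSum.sub (summable_digits hq hb'.1).hasSum).mul_left q
    rw [← ha'.2, ← hb'.2, sub_self, mul_zero] at h
    refine h.congr_fun fun n => ?_
    push_cast
    rw [pow_succ, inv_pow]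
    field_simp

/-! ### The decreasing sequence of bases -/

lemma quartic_sub_ge {u v : ℝ} (hu : 17 / 10 ≤ u) (huv : u ≤ v) :
    v - u ≤ (v ^ 4 - 2 * v ^ 2 - v - 1) - (u ^ 4 - 2 * u ^ 2 - u - 1) := by
  have hfac : (v ^ 4 - 2 * v ^ 2 - v - 1) - (u ^ 4 - 2 * u ^ 2 - u - 1) =
      (v - u) * ((v + u) * (v ^ 2 + u ^ 2 - 2) - 1) := by ring
  have h1 : (17 / 5 : ℝ) ≤ v + u := by linarith
  have h2 : 3 ≤ v ^ 2 + u ^ 2 - 2 := by nlinarith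
  have h3 : (1 : ℝ) ≤ (v + u) * (v ^ 2 + u ^ 2 - 2) - 1 := by nlinarith
  rw [hfac]
  nlinarith

lemma exists_base {q2 qf : ℝ} (hq2 : 17 / 10 ≤ q2) (hlt : q2 < qf)
    (hq2eq : q2 ^ 4 - 2 * q2 ^ 2 - q2 - 1 = 0)
    (hqfeq : qf ^ 3 = 2 * qf ^ 2 - qf + 1) (n : ℕ) :
    ∃ q ∈ Set.Ioo q2 qf, q ^ (2 * n + 3) * (q ^ 4 - 2 * q ^ 2 - q - 1) = 1 := by
  have hcont : ContinuousOn (fun q : ℝ => q ^ (2 * n + 3) * (q ^ 4 - 2 * q ^ 2 - q - 1))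
      (Set.Icc q2 qf) := by fun_prop
  refine intermediate_value_Ioo hlt.le hcont ⟨?_, ?_⟩
  · simp [hq2eq]
  · have hr : qf ^ 4 - 2 * qf ^ 2 - qf - 1 = (qf - 1) ^ 2 := by
      linear_combination (qf + 2) * hqfeq
    have hpow : qf ^ 3 ≤ qf ^ (2 * n + 3) := pow_le_pow_right₀ (by linarith) (by omega)
    have hqf : 17 / 10 < qf := by linarith
    have h1 : (17 / 10 : ℝ) ^ 3 ≤ qf ^ 3 := by gcongr
    have h2 : (49 / 100 : ℝ) ≤ (qf - 1) ^ 2 := by nlinarith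
    simp only [hr]
    nlinarith

theorem stmt11 (q2 qf : ℝ)
    (hq2 : q2 ∈ Set.Ioo (1:ℝ) 2) (hq2eq : q2 ^ 4 = 2 * q2 ^ 2 + q2 + 1)
    (hqf : qf ∈ Set.Ioo (1:ℝ) 2) (hqfeq : qf ^ 3 = 2 * qf ^ 2 - qf + 1) :
    (Baleph0 ∩ Set.Ioo q2 qf).Countable ∧ (Baleph0 ∩ Set.Ioo q2 qf).Infinite ∧
      ∃ Q : ℕ → ℝ,
        (∀ n, 1 ≤ n → Q n ∈ Set.Ioo q2 qf ∧ Q n ∈ Baleph0) ∧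
        StrictAntiOn Q {n : ℕ | 1 ≤ n} ∧
        Filter.Tendsto Q Filter.atTop (nhds q2) := by
  have hq2gt : 17 / 10 < q2 := by
    by_contra! hle
    have h1 := hq2.1
    have h2 : q2 ^ 2 ≤ (17 / 10) ^ 2 := by gcongr
    have h3 : q2 ^ 2 * (q2 ^ 2 - 2) ≤ q2 ^ 2 * ((17 / 10) ^ 2 - 2) := by gcongr
    nlinarith
  have hq2root : q2 ^ 4 - 2 * q2 ^ 2 - q2 - 1 = 0 := by linarith
  have hlt : q2 < qf := by
    by_contra! hle
    have hqfgt : 17 / 10 < qf := by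
      by_contra! hle'
      have h1 := hqf.1
      nlinarith [mul_nonneg (sub_nonneg.2 h1.le) (sub_nonneg.2 hle')]
    have h := quartic_sub_ge hqfgt.le hle
    have hr : qf ^ 4 - 2 * qf ^ 2 - qf - 1 = (qf - 1) ^ 2 := by
      linear_combination (qf + 2) * hqfeq
    rw [hq2root, hr] at h
    nlinarith
  have hG : (1 + Real.sqrt 5) / 2 < q2 := by
    have : Real.sqrt 5 < 12 / 5 := by
      rw [Real.sqrt_lt' (by norm_num)]
      norm_num
    linarith
  choose Q hQmem hQeq using exists_base hq2gt.le hlt hq2root hqfeq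
  have hQB : ∀ n, Q n ∈ Baleph0 := by
    intro n
    have hl := (hQmem n).1
    have hu := (hQmem n).2.trans hqf.2
    obtain ⟨x, hx⟩ := mk_expansionsOf_eq_aleph0 (hq2gt.trans hl) hu.le (hQeq n)
    have hne : (expansionsOf (Q n) x).Nonempty := by
      rw [← Set.nonempty_coe_sort, ← Cardinal.mk_ne_zero_iff, hx]
      exact Cardinal.aleph0_ne_zero
    exact ⟨⟨hG.trans hl, hu⟩, x, hne.some_mem.mem_Icc (by linarith), hx⟩
  have hanti : StrictAnti Q := by
    refine strictAnti_nat_of_succ_lt fun n => ?_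
    by_contra! hle
    have hn := (hQmem n).1
    have hmono := quartic_sub_ge (hq2gt.trans hn).le hle
    have hpos : 0 < Q n ^ 4 - 2 * Q n ^ 2 - Q n - 1 := by
      have := quartic_sub_ge hq2gt.le hn.le
      linarith
    have hpow : Q n ^ (2 * n + 3) < Q (n + 1) ^ (2 * (n + 1) + 3) :=
      calc Q n ^ (2 * n + 3) ≤ Q (n + 1) ^ (2 * n + 3) := by
            gcongr
            linarith
        _ < Q (n + 1) ^ (2 * (n + 1) + 3) := by
            apply pow_lt_pow_right₀ <;> [linarith; omega]
    have hprod : Q n ^ (2 * n + 3) * (Q n ^ 4 - 2 * Q n ^ 2 - Q n - 1) <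
        Q (n + 1) ^ (2 * (n + 1) + 3) *
          (Q (n + 1) ^ 4 - 2 * Q (n + 1) ^ 2 - Q (n + 1) - 1) :=
      mul_lt_mul hpow (by linarith) hpos (pow_nonneg (by linarith) _)
    rw [hQeq, hQeq] at hprod
    exact lt_irrefl _ hprod
  refine ⟨?_, ?_, Q, fun n _ => ⟨hQmem n, hQB n⟩, hanti.strictAntiOn _, ?_⟩
  · refine (Algebraic.countable ℤ ℝ).mono ?_
    rintro q ⟨⟨⟨-, hlt2⟩, x, -, hx⟩, hl, hu⟩
    have h1 : 1 < q := by linarith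
    refine isAlgebraic_of_mk_expansionsOf_eq_aleph0 h1 hlt2.le ?_ hx
    have hf := hqf.1
    have hfac : (q ^ 3 - 2 * q ^ 2 + q - 1) - (qf ^ 3 - 2 * qf ^ 2 + qf - 1) =
        -((qf - q) * (q ^ 2 + q * qf + qf ^ 2 - 2 * q - 2 * qf + 1)) := by ring
    have hpos : 0 ≤ q ^ 2 + q * qf + qf ^ 2 - 2 * q - 2 * qf + 1 := by nlinarith
    nlinarith [mul_nonneg (sub_nonneg.2 hu.le) hpos]
  · exact (Set.infinite_range_of_injective hanti.injective).mono
      (Set.range_subset_iff.2 fun n => ⟨hQB n, hQmem n⟩)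
  · have hbound : ∀ n, Q n ≤ q2 + (17 / 10 : ℝ)⁻¹ ^ n := by
      intro n
      have hn := (hQmem n).1
      have h := quartic_sub_ge hq2gt.le hn.le
      rw [hq2root, sub_zero] at h
      have hpow : (17 / 10 : ℝ) ^ n ≤ Q n ^ (2 * n + 3) :=
        calc (17 / 10 : ℝ) ^ n ≤ Q n ^ n := by
              gcongr
              linarith
          _ ≤ Q n ^ (2 * n + 3) := pow_le_pow_right₀ (by linarith) (by omega)
      have hle : Q n - q2 ≤ 1 / (17 / 10 : ℝ) ^ n := by
        rw [le_div_iff₀ (by positivity), ← hQeq n, mul_comm (Q n ^ (2 * n + 3))]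
        exact mul_le_mul h hpow (by positivity) (by linarith)
      rw [inv_pow, ← one_div]
      linarith
    have hlim : Filter.Tendsto (fun n : ℕ => q2 + (17 / 10 : ℝ)⁻¹ ^ n) Filter.atTop
        (nhds (q2 + 0)) :=
      (tendsto_pow_atTop_nhds_zero_of_lt_one (by norm_num) (by norm_num)).const_add _
    rw [add_zero] at hlim
    exact tendsto_of_tendsto_of_tendsto_of_le_of_le tendsto_const_nhds hlim
      (fun n => (hQmem n).1.le) hbound
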